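/- Let g be a finite-dimensional unimodular real Lie algebra of dimension 2n that contains an abelian ideal a of codimension 2, and let J be any complex structure on g. If (g,J) admits a balanced Hermitian metric and also admits a pluriclosed Hermitian metric (possibly different), then (g,J) admits a Kähler Hermitian metric. -/

import Mathlib

open Module

section Defs

variable {L : Type*} [LieRing L] [LieAlgebra ℝ L]

/-- A complex structure on a real Lie algebra: `J² = -id` plus integrability. -/
def IsComplexStructure (J : L →ₗ[ℝ] L) : Prop :=
  (∀ x : L, J (J x) = -x) ∧
  (∀ x y : L, ⁅x, y⁆ - ⁅J x, J y⁆ + J ⁅J x, y⁆ + J ⁅x, J y⁆ = 0)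

/-- A Lie algebra is unimodular if every `ad x` is traceless. -/
def IsUnimodularLie (L : Type*) [LieRing L] [LieAlgebra ℝ L] : Prop :=
  ∀ x : L, LinearMap.trace ℝ L (LieAlgebra.ad ℝ L x) = 0

/-- A Hermitian metric on `(L, J)`: a `J`-compatible inner product. -/
structure HermMetric (J : L →ₗ[ℝ] L) : Type _ where
  B : L →ₗ[ℝ] L →ₗ[ℝ] ℝ
  symm : ∀ x y : L, B x y = B y x
  posdef : ∀ x : L, x ≠ 0 → 0 < B x x
  compat : ∀ x y : L, B (J x) (J y) = B x y

variable {J : L →ₗ[ℝ] L}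

/-- The Kähler form `ω(x,y) = ⟨Jx, y⟩`. -/
def HermMetric.omega (g : HermMetric J) (x y : L) : ℝ := g.B (J x) y

/-- Exterior differential of the Kähler form. -/
def HermMetric.dOmega (g : HermMetric J) (x y z : L) : ℝ :=
  - g.omega ⁅x, y⁆ z + g.omega ⁅x, z⁆ y - g.omega ⁅y, z⁆ x

/-- `dᶜω (x,y,z) = -dω(Jx, Jy, Jz)`. -/
def HermMetric.dcOmega (g : HermMetric J) (x y z : L) : ℝ :=
  - g.dOmega (J x) (J y) (J z)

/-- `d(dᶜω)` as a 4-form. -/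
def HermMetric.ddcOmega (g : HermMetric J) (x y z w : L) : ℝ :=
  - g.dcOmega ⁅x, y⁆ z w + g.dcOmega ⁅x, z⁆ y w - g.dcOmega ⁅x, w⁆ y z
  - g.dcOmega ⁅y, z⁆ x w + g.dcOmega ⁅y, w⁆ x z - g.dcOmega ⁅z, w⁆ x y

/-- The metric is Kähler if `dω = 0`. -/
def HermMetric.IsKahler (g : HermMetric J) : Prop :=
  ∀ x y z : L, g.dOmega x y z = 0

/-- The metric is pluriclosed if `d(dᶜω) = 0`. -/
def HermMetric.IsPluriclosed (g : HermMetric J) : Prop :=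
  ∀ x y z w : L, g.ddcOmega x y z w = 0

/-- The metric is balanced (dimension `2n`): for every orthonormal basis `f`,
`Σ_k dω(f_k, J f_k, x) = 0` for all `x`. -/
def HermMetric.IsBalanced (g : HermMetric J) (n : ℕ) : Prop :=
  ∀ f : Basis (Fin (2 * n)) ℝ L,
    (∀ i j, g.B (f i) (f j) = if i = j then 1 else 0) →
    ∀ x : L, (∑ k, g.dOmega (f k) (J (f k)) x) = 0

end Defs

section PosDef

variable {E : Type*} [AddCommGroup E] [Module ℝ E]

/-- The inner product space core of a positive definite symmetric bilinear form. -/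
abbrev innerCoreOfPosDef (B : E →ₗ[ℝ] E →ₗ[ℝ] ℝ) (hs : ∀ x y, B x y = B y x)
    (hp : ∀ x, x ≠ 0 → 0 < B x x) : InnerProductSpace.Core ℝ E where
  inner x y := B x y
  conj_inner_symm x y := by simpa using hs y x
  re_inner_nonneg x := by
    by_cases hx : x = 0
    · simp [hx]
    · simpa using (hp x hx).le
  add_left x y z := by simp
  smul_left x y r := by simp
  definite x hx := by
    by_contra h
    exact (hp x h).ne' hx

theorem exists_orthonormal_basis_extension [FiniteDimensional ℝ E]
    (B : E →ₗ[ℝ] E →ₗ[ℝ] ℝ) (hs : ∀ x y, B x y = B y x) (hp : ∀ x, x ≠ 0 → 0 < B x x)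
    {ι : Type*} [Fintype ι] [DecidableEq ι] (hι : finrank ℝ E = Fintype.card ι)
    (v : ι → E) (s : Set ι) (hv : ∀ i ∈ s, ∀ j ∈ s, B (v i) (v j) = if i = j then 1 else 0) :
    ∃ f : Basis ι ℝ E, (∀ i j, B (f i) (f j) = if i = j then 1 else 0) ∧
      ∀ i ∈ s, f i = v i := by
  let c := innerCoreOfPosDef B hs hp
  let : NormedAddCommGroup E := c.toNormedAddCommGroup
  let : InnerProductSpace ℝ E := InnerProductSpace.ofCore c.toCore
  have hv' : Orthonormal ℝ (s.domRestrict v) := by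
    rw [orthonormal_iff_ite]
    intro i j
    exact (hv i i.2 j j.2).trans (by simp only [Subtype.ext_iff])
  obtain ⟨f, hf⟩ := hv'.exists_orthonormalBasis_extension_of_card_eq hι
  refine ⟨f.toBasis, fun i j => ?_, fun i hi => by simpa using hf i hi⟩
  rw [f.coe_toBasis]
  exact orthonormal_iff_ite.1 f.orthonormal i j

theorem trace_eq_sum_of_orthonormal (B : E →ₗ[ℝ] E →ₗ[ℝ] ℝ)
    {ι : Type*} [Fintype ι] [DecidableEq ι] (f : Basis ι ℝ E)
    (hf : ∀ i j, B (f i) (f j) = if i = j then 1 else 0) (T : E →ₗ[ℝ] E) :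
    LinearMap.trace ℝ E T = ∑ i, B (T (f i)) (f i) := by
  rw [LinearMap.trace_eq_matrix_trace ℝ f, Matrix.trace]
  refine Finset.sum_congr rfl fun i _ => ?_
  rw [Matrix.diag_apply, LinearMap.toMatrix_apply]
  have h : B (T (f i)) (f i) = B (∑ j, f.repr (T (f i)) j • f j) (f i) := by rw [f.sum_repr]
  rw [h]
  simp only [map_sum, LinearMap.sum_apply, map_smul, LinearMap.smul_apply, hf]
  simp

theorem trace_eq_zero_of_posDef [FiniteDimensional ℝ E]
    (B : E →ₗ[ℝ] E →ₗ[ℝ] ℝ) (hs : ∀ x y, B x y = B y x) (hp : ∀ x, x ≠ 0 → 0 < B x x)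
    (T : E →ₗ[ℝ] E) (hT : ∀ x, B (T x) x = 0) : LinearMap.trace ℝ E T = 0 := by
  obtain ⟨f, hf, -⟩ := exists_orthonormal_basis_extension B hs hp
    (ι := Fin (finrank ℝ E)) (by simp) 0 ∅ (by simp)
  simp [trace_eq_sum_of_orthonormal B f hf, hT]

/-- A two-dimensional relative orthogonal complement has an orthonormal basis. -/
theorem exists_orthonormal_pair [FiniteDimensional ℝ E]
    (B : E →ₗ[ℝ] E →ₗ[ℝ] ℝ) (hs : ∀ x y, B x y = B y x) (hp : ∀ x, x ≠ 0 → 0 < B x x)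
    {b a : Submodule ℝ E} (hba : b ≤ a) (hd : finrank ℝ b + 2 = finrank ℝ a) :
    ∃ u ∈ a, ∃ v ∈ a, B u u = 1 ∧ B v v = 1 ∧ B u v = 0 ∧ (∀ x ∈ b, B u x = 0) ∧
      (∀ x ∈ b, B v x = 0) ∧ ∀ x ∈ a, x - B u x • u - B v x • v ∈ b := by
  let c := innerCoreOfPosDef B hs hp
  let : NormedAddCommGroup E := c.toNormedAddCommGroup
  let : InnerProductSpace ℝ E := InnerProductSpace.ofCore c.toCore
  have hin : ∀ x y : E, inner ℝ x y = B x y := fun _ _ => rfl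
  have hd' : finrank ℝ ↥(bᗮ ⊓ a) = 2 := by
    have := Submodule.finrank_add_inf_finrank_orthogonal hba
    omega
  let f := (stdOrthonormalBasis ℝ ↥(bᗮ ⊓ a)).reindex (finCongr hd')
  have ho := orthonormal_iff_ite.1 f.orthonormal
  have hperp : ∀ i, ∀ x ∈ b, B (f i) x = 0 := fun i x hx => by
    rw [← hin]
    exact Submodule.inner_left_of_mem_orthogonal hx (f i).2.1
  refine ⟨f 0, (f 0).2.2, f 1, (f 1).2.2, (ho 0 0).trans (if_pos rfl),
    (ho 1 1).trans (if_pos rfl), (ho 0 1).trans (if_neg (by decide)), hperp 0, hperp 1,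
    fun x hx => ?_⟩
  obtain ⟨y, hy, z, hz, rfl⟩ := b.exists_add_mem_mem_orthogonal x
  have hza : z ∈ a := by simpa using a.sub_mem hx (hba hy)
  have hz' := congrArg Subtype.val (f.sum_repr' ⟨z, hz, hza⟩)
  simp only [Fin.sum_univ_two, Submodule.coe_inner, Submodule.coe_add, Submodule.coe_smul, hin]
    at hz'
  simp only [map_add, hperp 0 y hy, hperp 1 y hy, zero_add]
  rw [sub_sub, hz']
  simpa using hy

/-- A family of endomorphisms whose traces of squares add up to the sum of their squared norms
consists of symmetric endomorphisms. -/
theorem symmetric_of_sum_eq_zero [FiniteDimensional ℝ E]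
    (B : E →ₗ[ℝ] E →ₗ[ℝ] ℝ) (hs : ∀ x y, B x y = B y x) (hp : ∀ x, x ≠ 0 → 0 < B x x)
    (J : E →ₗ[ℝ] E) (hJ : ∀ x, J (J x) = -x) (hc : ∀ x y, B (J x) (J y) = B x y)
    {ι : Type*} [Fintype ι] (M : ι → E →ₗ[ℝ] E)
    (hM : ∀ x, ∑ i, (B (M i (M i x)) x - B (M i x) (M i x))
      + ∑ i, (B (M i (M i (J x))) (J x) - B (M i (J x)) (M i (J x))) = 0)
    (i : ι) (x y : E) : B (M i x) y = B x (M i y) := by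
  let c := innerCoreOfPosDef B hs hp
  let : NormedAddCommGroup E := c.toNormedAddCommGroup
  let : InnerProductSpace ℝ E := InnerProductSpace.ofCore c.toCore
  have hin : ∀ x y : E, inner ℝ x y = B x y := fun _ _ => rfl
  have hadj : ∀ (N : E →ₗ[ℝ] E) x y, B (LinearMap.adjoint N x) y = B x (N y) := fun N x y =>
    LinearMap.adjoint_inner_left N y x
  have hadj' : ∀ (N : E →ₗ[ℝ] E), LinearMap.adjoint (LinearMap.adjoint N) = N :=
    LinearMap.adjoint_adjoint
  have htr : ∀ (N : E →ₗ[ℝ] E), LinearMap.trace ℝ E (LinearMap.adjoint N)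
      = LinearMap.trace ℝ E N := fun N => by
    obtain ⟨f, hf, -⟩ := exists_orthonormal_basis_extension B hs hp
      (ι := Fin (finrank ℝ E)) (by simp) 0 ∅ (by simp)
    simp only [trace_eq_sum_of_orthonormal B f hf, hadj]
    exact Finset.sum_congr rfl fun i _ => hs _ _
  set T : E →ₗ[ℝ] E := ∑ i, (M i ∘ₗ M i - LinearMap.adjoint (M i) ∘ₗ M i) with hT
  have hT0 : LinearMap.trace ℝ E T = 0 := by
    have h := trace_eq_zero_of_posDef B hs hp (T - J ∘ₗ T ∘ₗ J) fun x => by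
      have hJl : ∀ x y, B (J x) y = - B x (J y) := fun x y => by rw [← hc, hJ]; simp
      rw [← hM x]
      simp [hT, hJl, hadj, LinearMap.sum_apply]
      ring
    rw [map_sub, LinearMap.trace_comp_comm' (T ∘ₗ J) J] at h
    have h2 : (T ∘ₗ J) ∘ₗ J = -T := by ext x; simp [hJ]
    rw [h2, map_neg] at h
    linarith
  set N : ι → E →ₗ[ℝ] E := fun i => M i - LinearMap.adjoint (M i) with hN
  have hN0 : LinearMap.trace ℝ E (∑ i, LinearMap.adjoint (N i) ∘ₗ N i) = 0 := by
    have : ∀ i, LinearMap.trace ℝ E (LinearMap.adjoint (N i) ∘ₗ N i)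
        = (-2) * LinearMap.trace ℝ E (M i ∘ₗ M i - LinearMap.adjoint (M i) ∘ₗ M i) := fun i => by
      have h1 : LinearMap.trace ℝ E (LinearMap.adjoint (M i) ∘ₗ LinearMap.adjoint (M i))
          = LinearMap.trace ℝ E (M i ∘ₗ M i) := by
        rw [← LinearMap.adjoint_comp, htr]
      have h2 := LinearMap.trace_comp_comm' (M i) (LinearMap.adjoint (M i))
      simp only [hN, map_sub, hadj', LinearMap.sub_comp, LinearMap.comp_sub, h1, h2]
      ring
    rw [map_sum]
    simp only [this, ← Finset.mul_sum]
    rw [← map_sum, ← hT, hT0, mul_zero]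
  obtain ⟨f, hf, -⟩ := exists_orthonormal_basis_extension B hs hp
    (ι := Fin (finrank ℝ E)) (by simp) 0 ∅ (by simp)
  have hB0 : ∀ x, 0 ≤ B x x := fun x => by
    by_cases hx : x = 0
    · simp [hx]
    · exact (hp x hx).le
  rw [trace_eq_sum_of_orthonormal B f hf] at hN0
  simp only [LinearMap.sum_apply, LinearMap.comp_apply, map_sum, hadj] at hN0
  have hNi : N i = 0 := f.ext fun k => by
    by_contra hne
    have h1 := (Finset.sum_eq_zero_iff_of_nonneg
      (fun k _ => Finset.sum_nonneg fun i _ => hB0 _)).1 hN0 k (Finset.mem_univ k)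
    have h2 := (Finset.sum_eq_zero_iff_of_nonneg (fun i _ => hB0 _)).1 h1 i (Finset.mem_univ i)
    exact (hp _ hne).ne' h2
  have : M i = LinearMap.adjoint (M i) := sub_eq_zero.1 hNi
  conv_lhs => rw [this]
  exact hadj _ _ _

/-- For commuting skew endomorphisms `D₁`, `D₂`, every 1-cocycle is cohomologous to one with
values in the common kernel. -/
theorem exists_cocycle_correction [FiniteDimensional ℝ E]
    (B : E →ₗ[ℝ] E →ₗ[ℝ] ℝ) (hs : ∀ x y, B x y = B y x) (hp : ∀ x, x ≠ 0 → 0 < B x x)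
    (D₁ D₂ : E →ₗ[ℝ] E) (h₁ : ∀ x y, B (D₁ x) y = -B x (D₁ y))
    (h₂ : ∀ x y, B (D₂ x) y = -B x (D₂ y)) (hD : ∀ x, D₁ (D₂ x) = D₂ (D₁ x))
    (y₁ y₂ : E) (hy : D₁ y₂ = D₂ y₁) :
    ∃ w, D₁ (y₁ + D₁ w) = 0 ∧ D₂ (y₁ + D₁ w) = 0 ∧ D₁ (y₂ + D₂ w) = 0 ∧
      D₂ (y₂ + D₂ w) = 0 := by
  let c := innerCoreOfPosDef B hs hp
  let : NormedAddCommGroup E := c.toNormedAddCommGroup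
  let : InnerProductSpace ℝ E := InnerProductSpace.ofCore c.toCore
  have hin : ∀ x y : E, inner ℝ x y = B x y := fun _ _ => rfl
  have hB0 : ∀ x, 0 ≤ B x x := fun x => by
    by_cases hx : x = 0
    · simp [hx]
    · exact (hp x hx).le
  have hB : ∀ x, B x x = 0 → x = 0 := fun x hx => by
    by_contra h
    exact (hp x h).ne' hx
  set C : E →ₗ[ℝ] E := D₁ ∘ₗ D₁ + D₂ ∘ₗ D₂ with hC
  have hker : ∀ x, C x = 0 → D₁ x = 0 ∧ D₂ x = 0 := fun x hx => by
    have h : B (C x) x = 0 := by simp [hx]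
    simp only [hC, LinearMap.add_apply, LinearMap.comp_apply, map_add, h₁ (D₁ x), h₂ (D₂ x)] at h
    exact ⟨hB _ (by linarith [hB0 (D₁ x), hB0 (D₂ x)]),
      hB _ (by linarith [hB0 (D₁ x), hB0 (D₂ x)])⟩
  have hsymm : C.IsSymmetric := fun x y => by
    simp only [hin, hC, LinearMap.add_apply, LinearMap.comp_apply, map_add, h₁, h₂, neg_neg]
  have hmem : D₁ y₁ + D₂ y₂ ∈ LinearMap.range C := by
    rw [← Submodule.orthogonal_orthogonal (LinearMap.range C), hsymm.orthogonal_range]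
    intro x hx
    obtain ⟨hx1, hx2⟩ := hker x hx
    have e1 := h₁ x y₁
    have e2 := h₂ x y₂
    rw [hx1] at e1
    rw [hx2] at e2
    simp only [map_zero, LinearMap.zero_apply] at e1 e2
    rw [hin, map_add]
    linarith
  obtain ⟨w, hw⟩ := hmem
  have hw' : D₁ (y₁ - D₁ w) + D₂ (y₂ - D₂ w) = 0 := by
    simp only [hC, LinearMap.add_apply, LinearMap.comp_apply] at hw
    rw [map_sub, map_sub, sub_add_sub_comm, hw, sub_self]
  have hz : D₁ (y₂ - D₂ w) = D₂ (y₁ - D₁ w) := by rw [map_sub, map_sub, hy, hD]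
  have k1 := hker (y₁ - D₁ w) (by
    simp only [hC, LinearMap.add_apply, LinearMap.comp_apply]
    rw [← hz, ← hD, ← map_add, hw', map_zero])
  have k2 := hker (y₂ - D₂ w) (by
    simp only [hC, LinearMap.add_apply, LinearMap.comp_apply]
    rw [hz, hD, ← map_add, hw', map_zero])
  refine ⟨-w, ?_⟩
  simp only [map_neg, ← sub_eq_add_neg]
  exact ⟨k1.1, k1.2, k2.1, k2.2⟩

end PosDef

section HermMetric

variable {L : Type*} [LieRing L] [LieAlgebra ℝ L] {J : L →ₗ[ℝ] L}

namespace HermMetric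

theorem B_J_left (g : HermMetric J) (hJ : ∀ x, J (J x) = -x) (x y : L) :
    g.B (J x) y = -g.B x (J y) := by
  rw [← g.compat, hJ]
  simp

theorem B_self_J (g : HermMetric J) (hJ : ∀ x, J (J x) = -x) (x : L) : g.B x (J x) = 0 := by
  have h1 := g.B_J_left hJ x x
  have h2 := g.symm (J x) x
  linarith

theorem B_self_nonneg (g : HermMetric J) (x : L) : 0 ≤ g.B x x := by
  by_cases hx : x = 0
  · simp [hx]
  · exact (g.posdef x hx).le

theorem eq_zero_of_B_self (g : HermMetric J) {x : L} (hx : g.B x x = 0) : x = 0 := by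
  by_contra h
  exact (g.posdef x h).ne' hx

/-- On a unimodular Lie algebra, a balanced metric satisfies `∑ [f_k, J f_k] = 0` for every
orthonormal basis. -/
theorem IsBalanced.sum_lie_eq_zero [FiniteDimensional ℝ L] {g : HermMetric J} {n : ℕ}
    (hg : g.IsBalanced n) (hJ : ∀ x, J (J x) = -x) (huni : IsUnimodularLie L)
    (f : Basis (Fin (2 * n)) ℝ L) (hf : ∀ i j, g.B (f i) (f j) = if i = j then 1 else 0) :
    ∑ k, ⁅f k, J (f k)⁆ = 0 := by
  have key : ∀ x, g.B (J (∑ k, ⁅f k, J (f k)⁆)) x = 0 := fun x => by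
    have h1 := trace_eq_sum_of_orthonormal g.B f hf (LieAlgebra.ad ℝ L x)
    have h2 := trace_eq_sum_of_orthonormal g.B f hf (J ∘ₗ LieAlgebra.ad ℝ L x ∘ₗ J)
    have h3 : (LieAlgebra.ad ℝ L x ∘ₗ J) ∘ₗ J = -LieAlgebra.ad ℝ L x := by
      ext y
      simp [hJ]
    rw [LinearMap.trace_comp_comm' (LieAlgebra.ad ℝ L x ∘ₗ J) J, h3, map_neg, huni x, neg_zero]
      at h2
    rw [huni x] at h1
    have h4 := hg f hf x
    have h5 : ∀ k, g.dOmega (f k) (J (f k)) x = -g.B (J ⁅f k, J (f k)⁆) x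
        - g.B (LieAlgebra.ad ℝ L x (f k)) (f k)
        + g.B ((J ∘ₗ LieAlgebra.ad ℝ L x ∘ₗ J) (f k)) (f k) := fun k => by
      simp only [dOmega, omega, g.compat, LieAlgebra.ad_apply, LinearMap.comp_apply]
      rw [← lie_skew x (f k), ← lie_skew x (J (f k))]
      simp only [map_neg, LinearMap.neg_apply]
      ring
    simp only [h5, Finset.sum_add_distrib, Finset.sum_sub_distrib, Finset.sum_neg_distrib] at h4
    rw [map_sum, map_sum, LinearMap.sum_apply]
    linarith
  have h0 := g.eq_zero_of_B_self (key _)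
  have h1 := congrArg J h0
  rwa [hJ, map_zero, neg_eq_zero] at h1

theorem exists_orthonormal_basis_of_frame [FiniteDimensional ℝ L] (g : HermMetric J) {n m : ℕ}
    (hdim : finrank ℝ L = n) (v : Fin m → L)
    (hv : ∀ i j, g.B (v i) (v j) = if i = j then 1 else 0) :
    ∃ (k : ℕ) (e : Fin m ⊕ Fin k ≃ Fin n) (f : Basis (Fin n) ℝ L),
      (∀ i j, g.B (f i) (f j) = if i = j then 1 else 0) ∧ ∀ i, f (e (Sum.inl i)) = v i := by
  have hli : LinearIndependent ℝ v := by
    rw [Fintype.linearIndependent_iff]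
    intro c hc i
    have h := congrArg (g.B (v i)) hc
    simpa [hv] using h
  have hm : m ≤ n := by
    have := hli.fintype_card_le_finrank
    simpa [hdim] using this
  obtain ⟨k, rfl⟩ := Nat.exists_eq_add_of_le hm
  obtain ⟨f, hf, hfv⟩ := exists_orthonormal_basis_extension g.B g.symm g.posdef
    (ι := Fin m ⊕ Fin k) (by simp [hdim]) (Sum.elim v 0) (Set.range Sum.inl) (by
      rintro _ ⟨i, rfl⟩ _ ⟨j, rfl⟩
      simp [hv])
  refine ⟨k, finSumFinEquiv, f.reindex finSumFinEquiv, fun i j => ?_, fun i => ?_⟩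
  · simp [hf]
  · simp only [Basis.reindex_apply, Equiv.symm_apply_apply]
    exact hfv _ ⟨i, rfl⟩

/-- The balanced condition only involves an orthonormal frame of the orthogonal complement of
an abelian part. -/
theorem IsBalanced.sum_lie_frame_eq_zero [FiniteDimensional ℝ L] {g : HermMetric J} {n : ℕ}
    (hg : g.IsBalanced n) (hJ : ∀ x, J (J x) = -x) (huni : IsUnimodularLie L)
    (hdim : finrank ℝ L = 2 * n) {m : ℕ} (v : Fin m → L)
    (hv : ∀ i j, g.B (v i) (v j) = if i = j then 1 else 0)
    (hb : ∀ x, (∀ i, g.B (v i) x = 0) → ⁅x, J x⁆ = 0) :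
    ∑ i, ⁅v i, J (v i)⁆ = 0 := by
  obtain ⟨k, e, f, hf, hfv⟩ := g.exists_orthonormal_basis_of_frame hdim v hv
  have h := hg.sum_lie_eq_zero hJ huni f hf
  rw [← e.sum_comp, Fintype.sum_sum_type] at h
  simp only [hfv] at h
  rwa [Finset.sum_eq_zero (s := Finset.univ) (f := fun j => ⁅f (e (Sum.inr j)), _⁆), add_zero] at h
  intro j _
  refine hb _ fun i => ?_
  rw [← hfv, hf, if_neg]
  simp

/-- The Hermitian metric making a `J`-linear projection orthogonal. -/
def ofProj (h : HermMetric J) (P : L →ₗ[ℝ] L) (hP : ∀ x, P (J x) = J (P x)) : HermMetric J where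
  B := h.B.compl₁₂ (LinearMap.id - P) (LinearMap.id - P) + h.B.compl₁₂ P P
  symm x y := by
    simp only [LinearMap.add_apply, LinearMap.compl₁₂_apply]
    rw [h.symm, h.symm (P x)]
  posdef x hx := by
    simp only [LinearMap.add_apply, LinearMap.compl₁₂_apply, LinearMap.sub_apply,
      LinearMap.id_apply]
    by_cases hPx : P x = 0
    · simpa [hPx] using h.posdef x hx
    · exact add_pos_of_nonneg_of_pos (h.B_self_nonneg _) (h.posdef _ hPx)
  compat x y := by
    simp only [LinearMap.add_apply, LinearMap.compl₁₂_apply, LinearMap.sub_apply,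
      LinearMap.id_apply, hP, ← map_sub, h.compat]

theorem ofProj_B (h : HermMetric J) (P : L →ₗ[ℝ] L) (hP : ∀ x, P (J x) = J (P x)) (x y : L) :
    (h.ofProj P hP).B x y = h.B (x - P x) (y - P y) + h.B (P x) (P y) := rfl

end HermMetric

/-- A `J`-invariant abelian ideal. -/
structure IsComplexAbelianIdeal (J : L →ₗ[ℝ] L) (b : Submodule ℝ L) : Prop where
  map_mem : ∀ x ∈ b, J x ∈ b
  lie_mem : ∀ z : L, ∀ x ∈ b, ⁅z, x⁆ ∈ b
  lie_eq_zero : ∀ x ∈ b, ∀ y ∈ b, ⁅x, y⁆ = 0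

/-- `L` acts on `b` by infinitesimal symmetries of the Kähler form. -/
def HermMetric.PreservedOn (h : HermMetric J) (b : Submodule ℝ L) : Prop :=
  ∀ z : L, ∀ x ∈ b, ∀ y ∈ b, h.B (J ⁅z, x⁆) y = h.B x (J ⁅z, y⁆)

variable {b : Submodule ℝ L}

namespace IsComplexAbelianIdeal

theorem dOmega_eq (hb : IsComplexAbelianIdeal J b) (h : HermMetric J)
    (hJ : ∀ x, J (J x) = -x) (z : L) {x y : L} (hx : x ∈ b) (hy : y ∈ b) :
    h.dOmega z x y = -h.B (J ⁅z, x⁆) y - h.B (J x) ⁅z, y⁆ := by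
  simp only [HermMetric.dOmega, HermMetric.omega, hb.lie_eq_zero x hx y hy, map_zero,
    LinearMap.zero_apply]
  rw [h.symm (J x), h.B_J_left hJ ⁅z, y⁆]
  ring

theorem dcOmega_eq (hb : IsComplexAbelianIdeal J b) (h : HermMetric J)
    (hJ : ∀ x, J (J x) = -x) (z : L) {x y : L} (hx : x ∈ b) (hy : y ∈ b) :
    h.dcOmega x z y = -h.B (J ⁅J z, J x⁆) (J y) - h.B (J (J x)) ⁅J z, J y⁆ := by
  have h1 := hb.dOmega_eq h hJ (J z) (hb.map_mem x hx) (hb.map_mem y hy)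
  rw [← h1]
  simp only [HermMetric.dcOmega, HermMetric.dOmega, HermMetric.omega]
  rw [← lie_skew (J x) (J z)]
  simp only [map_neg, LinearMap.neg_apply]
  ring

theorem ddcOmega_eq (hb : IsComplexAbelianIdeal J b) (h : HermMetric J)
    (hJ : ∀ x, J (J x) = -x) (e : L) {x : L} (hx : x ∈ b) :
    h.ddcOmega e (J e) x (J x) = h.dOmega (J ⁅e, J e⁆) (J x) (J (J x))
      - (h.B (J ⁅e, J ⁅e, x⁆⁆) x - h.B (J ⁅e, x⁆) (J ⁅e, x⁆))
      - (h.B (J ⁅e, J ⁅e, J x⁆⁆) (J x) - h.B (J ⁅e, J x⁆) (J ⁅e, J x⁆))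
      - (h.B (J ⁅J e, J ⁅J e, x⁆⁆) x - h.B (J ⁅J e, x⁆) (J ⁅J e, x⁆))
      - (h.B (J ⁅J e, J ⁅J e, J x⁆⁆) (J x) - h.B (J ⁅J e, J x⁆) (J ⁅J e, J x⁆)) := by
  have hx' := hb.map_mem x hx
  have h0 : h.dcOmega ⁅x, J x⁆ e (J e) = 0 := by
    rw [hb.lie_eq_zero x hx _ hx']
    simp [HermMetric.dcOmega, HermMetric.dOmega, HermMetric.omega]
  have h1 : h.dcOmega ⁅e, J e⁆ x (J x) = -h.dOmega (J ⁅e, J e⁆) (J x) (J (J x)) := rfl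
  rw [HermMetric.ddcOmega, h0, h1,
    hb.dcOmega_eq h hJ (J e) (hb.lie_mem e x hx) hx',
    hb.dcOmega_eq h hJ (J e) (hb.lie_mem e _ hx') hx,
    hb.dcOmega_eq h hJ e (hb.lie_mem (J e) x hx) hx',
    hb.dcOmega_eq h hJ e (hb.lie_mem (J e) _ hx') hx]
  simp only [hJ, neg_lie, lie_neg, map_neg, LinearMap.neg_apply, h.compat]
  ring

/-- If `∑ [f_k, J f_k] = 0` for a basis `f`, then for any pluriclosed metric `L` acts on a
`J`-invariant abelian ideal by infinitesimal symmetries of the Kähler form. -/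
theorem preservedOn_of_isPluriclosed [FiniteDimensional ℝ L] (hb : IsComplexAbelianIdeal J b)
    {h : HermMetric J} (hh : h.IsPluriclosed) (hJ : ∀ x, J (J x) = -x) {n : ℕ}
    (f : Basis (Fin n) ℝ L) (hf : ∑ k, ⁅f k, J (f k)⁆ = 0) : h.PreservedOn b := by
  let z : Fin n ⊕ Fin n → L := Sum.elim f (fun k => J (f k))
  let Jb : b →ₗ[ℝ] b := J.restrict hb.map_mem
  let M : Fin n ⊕ Fin n → b →ₗ[ℝ] b := fun i =>
    Jb ∘ₗ (LieAlgebra.ad ℝ L (z i)).restrict (hb.lie_mem (z i))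
  have hM : ∀ i (x : b), (M i x : L) = J ⁅z i, (x : L)⁆ := fun _ _ => rfl
  have key := symmetric_of_sum_eq_zero (h.B.domRestrict₁₂ b b)
    (fun x y => h.symm x y) (fun x hx => h.posdef x (by simpa using hx)) Jb
    (fun x => Subtype.ext (hJ x)) (fun x y => h.compat x y) M (fun x => by
      have hs : ∑ k, h.dOmega (J ⁅f k, J (f k)⁆) (J x) (J (J x)) = 0 := by
        simp only [fun k => hb.dOmega_eq h hJ (J ⁅f k, J (f k)⁆) (hb.map_mem x x.2)
          (hb.map_mem _ (hb.map_mem x x.2))]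
        rw [Finset.sum_sub_distrib, Finset.sum_neg_distrib]
        simp only [← map_sum, ← LinearMap.sum_apply, ← sum_lie, hf]
        simp
      have hz : ∑ k, h.ddcOmega (f k) (J (f k)) x (J x) = 0 :=
        Finset.sum_eq_zero fun k _ => hh _ _ _ _
      simp only [fun k => hb.ddcOmega_eq h hJ (f k) x.2, Finset.sum_sub_distrib, hs] at hz
      simp only [LinearMap.domRestrict₁₂_apply, hM, Fintype.sum_sum_type, z, Sum.elim_inl,
        Sum.elim_inr, Finset.sum_sub_distrib, show ((Jb x : b) : L) = J x from rfl]
      linarith)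
  intro w x hx y hy
  have hlin : h.B.flip y ∘ₗ J ∘ₗ (LieAlgebra.ad ℝ L x : L →ₗ[ℝ] L)
      = h.B x ∘ₗ J ∘ₗ (LieAlgebra.ad ℝ L y : L →ₗ[ℝ] L) := f.ext fun k => by
    have := key (Sum.inl k) ⟨x, hx⟩ ⟨y, hy⟩
    simp only [LinearMap.domRestrict₁₂_apply, hM, z, Sum.elim_inl] at this
    simp only [LinearMap.comp_apply, LieAlgebra.ad_apply, LinearMap.flip_apply]
    rw [← lie_skew x, ← lie_skew y]
    simp only [map_neg, LinearMap.neg_apply, this]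
  have := LinearMap.congr_fun hlin w
  simp only [LinearMap.comp_apply, LieAlgebra.ad_apply, LinearMap.flip_apply] at this
  rw [← lie_skew w, ← lie_skew w]
  simp only [map_neg, LinearMap.neg_apply, this]

theorem exists_isKahler (hb : IsComplexAbelianIdeal J b) {h : HermMetric J}
    (hh : h.PreservedOn b) (P : L →ₗ[ℝ] L)
    (hPJ : ∀ x, P (J x) = J (P x)) (hPid : ∀ x, x - P x ∈ b) (hPb : ∀ x ∈ b, P x = 0)
    (hPP : ∀ x y, ⁅P x, P y⁆ = 0) : ∃ k : HermMetric J, k.IsKahler := by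
  refine ⟨h.ofProj P hPJ, fun x y z => ?_⟩
  have hω : ∀ x y z, (h.ofProj P hPJ).omega ⁅x, y⁆ z
      = h.B (J ⁅P x, y - P y⁆) (z - P z) - h.B (J ⁅P y, x - P x⁆) (z - P z) := fun x y z => by
    have hxy : ⁅x, y⁆ = ⁅P x, y - P y⁆ - ⁅P y, x - P x⁆ := by
      have h1 := hb.lie_eq_zero _ (hPid x) _ (hPid y)
      have h2 := hPP x y
      rw [← lie_skew (P y) (x - P x), sub_neg_eq_add]
      simp only [sub_lie, lie_sub, h2] at h1 ⊢
      linear_combination (norm := module) h1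
    have hmem : J ⁅x, y⁆ ∈ b := by
      rw [hxy]
      exact hb.map_mem _ (b.sub_mem (hb.lie_mem _ _ (hPid y)) (hb.lie_mem _ _ (hPid x)))
    rw [HermMetric.omega, HermMetric.ofProj_B, hPb _ hmem, hxy]
    simp
  rw [HermMetric.dOmega, hω, hω, hω, hh _ _ (hPid y) _ (hPid z), hh _ _ (hPid x) _ (hPid z),
    hh _ _ (hPid x) _ (hPid y), h.symm (y - P y), h.symm (x - P x), h.symm (x - P x)]
  ring

end IsComplexAbelianIdeal

theorem lie_J_J (hJ : IsComplexStructure J) (x y : L) :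
    ⁅J x, J y⁆ = ⁅x, y⁆ + J (⁅J x, y⁆ - ⁅J y, x⁆) := by
  have h := hJ.2 x y
  rw [← lie_skew x (J y), map_neg] at h
  rw [map_sub]
  linear_combination (norm := module) -h

/-- The case of a `J`-invariant abelian ideal of codimension two. -/
theorem IsComplexAbelianIdeal.exists_isKahler_of_finrank [FiniteDimensional ℝ L]
    (hb : IsComplexAbelianIdeal J b) (hcodim : finrank ℝ b + 2 = finrank ℝ L)
    (hJ : IsComplexStructure J) (huni : IsUnimodularLie L) {n : ℕ} (hdim : finrank ℝ L = 2 * n)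
    {g h : HermMetric J} (hg : g.IsBalanced n) (hh : h.PreservedOn b) :
    ∃ k : HermMetric J, k.IsKahler := by
  have hJJ := hJ.1
  obtain ⟨u, -, v, -, huu, hvv, huv, hub, hvb, hdec⟩ := exists_orthonormal_pair g.B g.symm g.posdef
    (le_top : b ≤ ⊤) (by rw [hcodim, finrank_top])
  have huJ := g.B_self_J hJJ u
  have hperp : ∀ x, g.B u x = 0 → g.B (J u) x = 0 → x ∈ b := fun x hx hJx => by
    have hm := hdec (J u) trivial
    rw [huJ, zero_smul, sub_zero] at hm
    have hm0 : J u - g.B v (J u) • v = 0 := g.eq_zero_of_B_self <| by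
      rw [LinearMap.map_sub₂, LinearMap.map_smul₂, g.B_J_left hJJ,
        hub _ (hb.map_mem _ hm), hvb _ hm]
      simp
    rw [sub_eq_zero] at hm0
    have hne : g.B v (J u) ≠ 0 := fun h0 => by
      rw [h0, zero_smul] at hm0
      have := g.compat u u
      rw [hm0, huu] at this
      simp at this
    rw [hm0, map_smul, LinearMap.smul_apply, smul_eq_mul] at hJx
    have hvx := (mul_eq_zero.1 hJx).resolve_left hne
    have := hdec x trivial
    rwa [hx, hvx, zero_smul, zero_smul, sub_zero, sub_zero] at this
  have hlie : ⁅u, J u⁆ = 0 := by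
    have hs := hg.sum_lie_frame_eq_zero hJJ huni hdim ![u, J u] (fun i j => by
      have huJ' : g.B (J u) u = 0 := by rw [g.symm, huJ]
      fin_cases i <;> fin_cases j <;> simp [huu, huJ, huJ', g.compat]) (fun x hx =>
        have hxb := hperp x (hx 0) (hx 1)
        hb.lie_eq_zero x hxb _ (hb.map_mem x hxb))
    simp only [Fin.sum_univ_two, Matrix.cons_val_zero, Matrix.cons_val_one, hJJ, lie_neg] at hs
    rw [lie_skew] at hs
    have h2 : (2 : ℝ) • ⁅u, J u⁆ = 0 := by linear_combination (norm := module) hs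
    exact (smul_eq_zero.1 h2).resolve_left two_ne_zero
  refine hb.exists_isKahler hh ((g.B u).smulRight u + (g.B (J u)).smulRight (J u)) (fun x => ?_)
    (fun x => ?_) (fun x hx => ?_) (fun x y => ?_)
  · simp only [LinearMap.add_apply, LinearMap.smulRight_apply, map_add, map_smul, hJJ, g.compat,
      g.B_J_left hJJ u x]
    module
  · have hJu : g.B (J u) u = 0 := by rw [g.symm, huJ]
    apply hperp <;> simp [huu, huJ, hJu, g.compat]
  · simp [hub x hx, g.B_J_left hJJ, hub _ (hb.map_mem x hx)]
  · have hlie' : ⁅J u, u⁆ = 0 := by rw [← lie_skew, hlie, neg_zero]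
    simp [hlie, hlie']

/-- A frame `u`, `v` with dual functionals `θ`, `η` of a complement of `a ∩ J a` in an abelian
ideal `a` such that `a + J a` is the whole algebra. -/
structure IsTotallyRealFrame (J : L →ₗ[ℝ] L) (a : LieIdeal ℝ L) (u v : L) (θ η : L →ₗ[ℝ] ℝ) :
    Prop where
  lie_eq_zero : ∀ x ∈ a, ∀ y ∈ a, ⁅x, y⁆ = 0
  exists_eq : ∀ z, ∃ x ∈ a, ∃ y ∈ a, z = x + J y
  left_mem : u ∈ a
  right_mem : v ∈ a
  θ_left : θ u = 1
  θ_right : θ v = 0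
  η_left : η u = 0
  η_right : η v = 1
  θ_J : ∀ x ∈ a, θ (J x) = 0
  η_J : ∀ x ∈ a, η (J x) = 0
  J_sub_mem : ∀ x ∈ a, J (x - (θ x • u + η x • v)) ∈ a

/-- The largest `J`-invariant subspace of `a`. -/
def complexPart (J : L →ₗ[ℝ] L) (a : LieIdeal ℝ L) : Submodule ℝ L :=
  a.toSubmodule ⊓ a.toSubmodule.comap J

variable {a : LieIdeal ℝ L}

theorem mem_complexPart {x : L} : x ∈ complexPart J a ↔ x ∈ a ∧ J x ∈ a := Iff.rfl

theorem J_mem_complexPart (hJ : ∀ x, J (J x) = -x) {x : L} (hx : x ∈ complexPart J a) :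
    J x ∈ complexPart J a :=
  ⟨hx.2, by simpa [hJ] using hx.1⟩

/-- `ad (J y)` commutes with `J` on `a ∩ J a` for `y ∈ a`. -/
theorem lie_J_J_of_mem (hJ : IsComplexStructure J)
    (hab : ∀ x ∈ a, ∀ y ∈ a, ⁅x, y⁆ = 0) {y w : L} (hy : y ∈ a) (hw : w ∈ complexPart J a) :
    ⁅J y, J w⁆ = J ⁅J y, w⁆ := by
  rw [lie_J_J hJ, hab y hy w hw.1, hab _ hw.2 y hy]
  simp

namespace IsTotallyRealFrame

variable {u v : L} {θ η : L →ₗ[ℝ] ℝ}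

theorem isComplexAbelianIdeal (hF : IsTotallyRealFrame J a u v θ η) (hJ : IsComplexStructure J) :
    IsComplexAbelianIdeal J (complexPart J a) where
  map_mem _ hx := J_mem_complexPart hJ.1 hx
  lie_mem z w hw := by
    obtain ⟨x, hx, y, hy, rfl⟩ := hF.exists_eq z
    rw [add_lie, hF.lie_eq_zero x hx w hw.1, zero_add, mem_complexPart,
      ← lie_J_J_of_mem hJ hF.lie_eq_zero hy hw]
    exact ⟨lie_mem_right ℝ L a _ _ hw.1, lie_mem_right ℝ L a _ _ hw.2⟩
  lie_eq_zero x hx y hy := hF.lie_eq_zero x hx.1 y hy.1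

theorem sub_mem_complexPart (hF : IsTotallyRealFrame J a u v θ η) {x : L} (hx : x ∈ a) :
    x - (θ x • u + η x • v) ∈ complexPart J a :=
  ⟨sub_mem hx (add_mem (a.smul_mem _ hF.left_mem) (a.smul_mem _ hF.right_mem)),
    hF.J_sub_mem x hx⟩

theorem θ_eq_zero (hF : IsTotallyRealFrame J a u v θ η) (hJ : ∀ x, J (J x) = -x) {x : L}
    (hx : x ∈ complexPart J a) : θ x = 0 := by
  simpa [hJ] using hF.θ_J _ hx.2

theorem η_eq_zero (hF : IsTotallyRealFrame J a u v θ η) (hJ : ∀ x, J (J x) = -x) {x : L}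
    (hx : x ∈ complexPart J a) : η x = 0 := by
  simpa [hJ] using hF.η_J _ hx.2

end IsTotallyRealFrame

/-- The `J`-linear projection onto the span of `u`, `v`, `J u`, `J v`. -/
def frameProj (J : L →ₗ[ℝ] L) (u v : L) (θ η : L →ₗ[ℝ] ℝ) : L →ₗ[ℝ] L :=
  θ.smulRight u + η.smulRight v - (θ ∘ₗ J).smulRight (J u) - (η ∘ₗ J).smulRight (J v)

theorem frameProj_apply (u v : L) (θ η : L →ₗ[ℝ] ℝ) (x : L) :
    frameProj J u v θ η x = θ x • u + η x • v - θ (J x) • J u - η (J x) • J v := rfl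

namespace IsTotallyRealFrame

variable {u v : L} {θ η : L →ₗ[ℝ] ℝ}

theorem frameProj_J (hJ : ∀ x, J (J x) = -x) (x : L) :
    frameProj J u v θ η (J x) = J (frameProj J u v θ η x) := by
  simp only [frameProj_apply, hJ, map_neg, map_add, map_sub, map_smul]
  module

theorem sub_frameProj_mem (hF : IsTotallyRealFrame J a u v θ η) (hJ : ∀ x, J (J x) = -x) (z : L) :
    z - frameProj J u v θ η z ∈ complexPart J a := by
  obtain ⟨x, hx, y, hy, rfl⟩ := hF.exists_eq z
  have h := add_mem (hF.sub_mem_complexPart hx) (J_mem_complexPart hJ (hF.sub_mem_complexPart hy))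
  convert h using 1
  simp only [frameProj_apply, map_add, map_sub, map_smul, hJ, map_neg, hF.θ_J _ hx, hF.η_J _ hx,
    hF.θ_J _ hy, hF.η_J _ hy]
  module

theorem frameProj_eq_zero (hF : IsTotallyRealFrame J a u v θ η) (hJ : ∀ x, J (J x) = -x) {x : L}
    (hx : x ∈ complexPart J a) : frameProj J u v θ η x = 0 := by
  have hx' := J_mem_complexPart hJ hx
  simp [frameProj_apply, hF.θ_eq_zero hJ hx, hF.η_eq_zero hJ hx, hF.θ_eq_zero hJ hx',
    hF.η_eq_zero hJ hx']

theorem skew (hF : IsTotallyRealFrame J a u v θ η) (hJ : IsComplexStructure J) {h : HermMetric J}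
    (hh : h.PreservedOn (complexPart J a)) {z x y : L} (hz : z ∈ a) (hx : x ∈ complexPart J a)
    (hy : y ∈ complexPart J a) : h.B ⁅J z, x⁆ y = -h.B x ⁅J z, y⁆ := by
  rw [← h.compat, hh _ _ hx _ (J_mem_complexPart hJ.1 hy), lie_J_J_of_mem hJ hF.lie_eq_zero hz hy,
    hJ.1, map_neg]

/-- Unimodularity only involves the action on the frame. -/
theorem trace_frame_eq_zero [FiniteDimensional ℝ L] (hF : IsTotallyRealFrame J a u v θ η)
    (hJ : IsComplexStructure J) {h : HermMetric J} (hh : h.PreservedOn (complexPart J a))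
    (huni : IsUnimodularLie L) {z : L} (hz : z ∈ a) :
    θ ⁅J z, u⁆ + η ⁅J z, v⁆ - θ (J ⁅J z, J u⁆) - η (J ⁅J z, J v⁆) = 0 := by
  set P := frameProj J u v θ η with hP
  set T := (LieAlgebra.ad ℝ L (J z) : L →ₗ[ℝ] L) with hT
  let k := h.ofProj P (frameProj_J hJ.1)
  have h1 : LinearMap.trace ℝ L (T ∘ₗ (LinearMap.id - P)) = 0 :=
    trace_eq_zero_of_posDef k.B k.symm k.posdef _ fun x => by
      have hx := hF.sub_frameProj_mem hJ.1 x
      have hm := (hF.isComplexAbelianIdeal hJ).lie_mem (J z) _ hx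
      have h2 : P ⁅J z, x - P x⁆ = 0 := hF.frameProj_eq_zero hJ.1 hm
      have h3 := hF.skew hJ hh hz hx hx
      rw [h.symm (x - _)] at h3
      change (h.ofProj P (frameProj_J hJ.1)).B ⁅J z, x - P x⁆ x = 0
      rw [HermMetric.ofProj_B, h2, sub_zero, map_zero, LinearMap.zero_apply, add_zero]
      linarith
  have h2 : LinearMap.trace ℝ L (T ∘ₗ P) = 0 := by
    rw [LinearMap.comp_sub, map_sub, LinearMap.comp_id, huni (J z), zero_sub, neg_eq_zero] at h1
    exact h1
  rw [← h2, LinearMap.trace_comp_comm', hP, frameProj]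
  have hc : ∀ (f : L →ₗ[ℝ] ℝ) (x : L), f.smulRight x ∘ₗ T = (f ∘ₗ T).smulRight x :=
    fun _ _ => rfl
  simp only [LinearMap.sub_comp, LinearMap.add_comp, hc, map_sub, map_add,
    LinearMap.trace_smulRight]
  rfl

theorem apply_lie (hF : IsTotallyRealFrame J a u v θ η) (hJ : IsComplexStructure J)
    {f : L →ₗ[ℝ] ℝ} (hf : ∀ x ∈ complexPart J a, f x = 0) (z : L) {y : L} (hy : y ∈ a) :
    f ⁅z, y⁆ = θ y * f ⁅z, u⁆ + η y * f ⁅z, v⁆ := by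
  have h := hf _ ((hF.isComplexAbelianIdeal hJ).lie_mem z _ (hF.sub_mem_complexPart hy))
  simp only [lie_sub, lie_add, lie_smul, map_sub, map_add, map_smul, smul_eq_mul] at h
  linarith

theorem lie_J_apply (hF : IsTotallyRealFrame J a u v θ η) {x y : L} (hx : x ∈ a) (hy : y ∈ a) :
    ⁅J y, x⁆ = θ y • ⁅J u, x⁆ + η y • ⁅J v, x⁆ := by
  have h := hF.lie_eq_zero _ (hF.J_sub_mem y hy) x hx
  simp only [map_sub, map_add, map_smul, sub_lie, add_lie, smul_lie] at h
  exact sub_eq_zero.1 h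

/-- The two-dimensional left-symmetric algebra `a / (a ∩ J a)` is trivial. -/
theorem lie_mem_complexPart [FiniteDimensional ℝ L] (hF : IsTotallyRealFrame J a u v θ η)
    (hJ : IsComplexStructure J) {h : HermMetric J} (hh : h.PreservedOn (complexPart J a))
    (huni : IsUnimodularLie L) (hps : ⁅J u, u⁆ + ⁅J v, v⁆ ∈ complexPart J a) :
    ⁅J u, u⁆ ∈ complexPart J a ∧ ⁅J u, v⁆ ∈ complexPart J a ∧ ⁅J v, u⁆ ∈ complexPart J a ∧
      ⁅J v, v⁆ ∈ complexPart J a := by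
  have hθ : ∀ x ∈ complexPart J a, θ x = 0 := fun x => hF.θ_eq_zero hJ.1
  have hη : ∀ x ∈ complexPart J a, η x = 0 := fun x => hF.η_eq_zero hJ.1
  have hmem : ∀ z, ∀ x ∈ a, ⁅z, x⁆ ∈ a := fun z x hx => lie_mem_right ℝ L a z x hx
  have hu := hF.left_mem
  have hv := hF.right_mem
  have hlie : ⁅J u, J v⁆ = J (⁅J u, v⁆ - ⁅J v, u⁆) := by
    rw [lie_J_J hJ, hF.lie_eq_zero u hu v hv, zero_add]
  have hlie' : ⁅J v, J u⁆ = -J (⁅J u, v⁆ - ⁅J v, u⁆) := by rw [← hlie, lie_skew]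
  have t1 := hF.trace_frame_eq_zero hJ hh huni hu
  have t2 := hF.trace_frame_eq_zero hJ hh huni hv
  rw [lie_self, hlie, hJ.1] at t1
  rw [lie_self, hlie', map_neg, hJ.1] at t2
  have s1 := hθ _ hps
  have s2 := hη _ hps
  have jac : ∀ x ∈ a, ⁅J u, ⁅J v, x⁆⁆ - ⁅J v, ⁅J u, x⁆⁆
      = θ (⁅J u, v⁆ - ⁅J v, u⁆) • ⁅J u, x⁆ + η (⁅J u, v⁆ - ⁅J v, u⁆) • ⁅J v, x⁆ := fun x hx => by
    rw [← hF.lie_J_apply hx (sub_mem (hmem _ _ hv) (hmem _ _ hu)), ← hlie, lie_lie]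
  have j1 := congrArg θ (jac v hv)
  have j2 := congrArg η (jac u hu)
  simp only [map_sub, map_add, map_smul, smul_eq_mul] at j1 j2
  rw [hF.apply_lie hJ hθ _ (hmem (J v) v hv), hF.apply_lie hJ hθ _ (hmem (J u) v hv)] at j1
  rw [hF.apply_lie hJ hη _ (hmem (J v) u hu), hF.apply_lie hJ hη _ (hmem (J u) u hu)] at j2
  simp only [map_sub, map_add, map_neg, map_zero, neg_neg] at t1 t2 s1 s2
  have hz : ∀ x ∈ a, θ x = 0 → η x = 0 → x ∈ complexPart J a := fun x hx h1 h2 => by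
    simpa [h1, h2] using hF.sub_mem_complexPart hx
  suffices hzero : (θ ⁅J u, u⁆ = 0 ∧ η ⁅J u, u⁆ = 0) ∧ (θ ⁅J u, v⁆ = 0 ∧ η ⁅J u, v⁆ = 0) ∧
      (θ ⁅J v, u⁆ = 0 ∧ η ⁅J v, u⁆ = 0) ∧ (θ ⁅J v, v⁆ = 0 ∧ η ⁅J v, v⁆ = 0) from
    ⟨hz _ (hmem _ _ hu) hzero.1.1 hzero.1.2, hz _ (hmem _ _ hv) hzero.2.1.1 hzero.2.1.2,
      hz _ (hmem _ _ hu) hzero.2.2.1.1 hzero.2.2.1.2,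
      hz _ (hmem _ _ hv) hzero.2.2.2.1 hzero.2.2.2.2⟩
  clear hz jac hps
  generalize θ ⁅J u, u⁆ = p₁, η ⁅J u, u⁆ = p₂, θ ⁅J u, v⁆ = q₁, η ⁅J u, v⁆ = q₂,
    θ ⁅J v, u⁆ = r₁, η ⁅J v, u⁆ = r₂, θ ⁅J v, v⁆ = s₁, η ⁅J v, v⁆ = s₂ at *
  obtain rfl : s₁ = -p₁ := by linarith
  obtain rfl : s₂ = -p₂ := by linarith
  obtain rfl : r₂ = p₁ + 2 * q₂ := by linarith
  obtain rfl : q₁ = 2 * r₁ - p₂ := by linarith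
  have hsum : p₁ ^ 2 + p₁ * q₂ + 2 * q₂ ^ 2 + (2 * r₁ ^ 2 - r₁ * p₂ + p₂ ^ 2) = 0 := by
    linarith
  obtain rfl : p₁ = 0 := by
    nlinarith [sq_nonneg (p₁ + 4 * q₂), sq_nonneg (4 * r₁ - p₂), sq_nonneg p₂]
  obtain rfl : p₂ = 0 := by
    nlinarith [sq_nonneg q₂, sq_nonneg (4 * r₁ - p₂)]
  obtain rfl : q₂ = 0 := by
    nlinarith [sq_nonneg r₁]
  obtain rfl : r₁ = 0 := by
    nlinarith
  simp

theorem add (hF : IsTotallyRealFrame J a u v θ η) (hJ : ∀ x, J (J x) = -x) {x y : L}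
    (hx : x ∈ complexPart J a) (hy : y ∈ complexPart J a) :
    IsTotallyRealFrame J a (u + x) (v + y) θ η where
  lie_eq_zero := hF.lie_eq_zero
  exists_eq := hF.exists_eq
  left_mem := add_mem hF.left_mem hx.1
  right_mem := add_mem hF.right_mem hy.1
  θ_left := by rw [map_add, hF.θ_left, hF.θ_eq_zero hJ hx, add_zero]
  θ_right := by rw [map_add, hF.θ_right, hF.θ_eq_zero hJ hy, add_zero]
  η_left := by rw [map_add, hF.η_left, hF.η_eq_zero hJ hx, add_zero]
  η_right := by rw [map_add, hF.η_right, hF.η_eq_zero hJ hy, add_zero]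
  θ_J := hF.θ_J
  η_J := hF.η_J
  J_sub_mem z hz := by
    have h := sub_mem (hF.J_sub_mem z hz)
      (add_mem (a.smul_mem (θ z) hx.2) (a.smul_mem (η z) hy.2))
    convert h using 1
    simp only [map_sub, map_add, map_smul]
    module

/-- If the brackets of the frame are central in the action of the frame, a pluriclosed metric
forces them to vanish. -/
theorem exists_isKahler_of_lie_lie_eq_zero (hF : IsTotallyRealFrame J a u v θ η)
    (hJ : IsComplexStructure J) {h : HermMetric J} (hh : h.PreservedOn (complexPart J a))
    (hpl : h.IsPluriclosed)
    (hmem : ∀ w ∈ ({u, v} : Set L), ∀ x ∈ ({u, v} : Set L), ⁅J w, x⁆ ∈ complexPart J a)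
    (hcen : ∀ w ∈ ({u, v} : Set L), ∀ x ∈ ({u, v} : Set L), ∀ y ∈ ({u, v} : Set L),
      ⁅J w, ⁅J x, y⁆⁆ = 0)
    {t : ℝ} (ht : t ^ 2 < 1) (hps : ⁅J u, u⁆ + ⁅J v, v⁆ + t • J (⁅J u, v⁆ - ⁅J v, u⁆) = 0) :
    ∃ k : HermMetric J, k.IsKahler := by
  have hJJ := hJ.1
  have hu := hF.left_mem
  have hv := hF.right_mem
  have hu' : u ∈ ({u, v} : Set L) := .inl rfl
  have hv' : v ∈ ({u, v} : Set L) := .inr rfl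
  have huv := hF.lie_eq_zero u hu v hv
  have hlie : ⁅J u, J v⁆ = J (⁅J u, v⁆ - ⁅J v, u⁆) := by rw [lie_J_J hJ, huv, zero_add]
  have hp := hmem u hu' u hu'
  have hq := hmem u hu' v hv'
  have hr := hmem v hv' u hu'
  have hs := hmem v hv' v hv'
  have hpu := hcen u hu' u hu' u hu'
  have hpv := hcen v hv' u hu' u hu'
  have hqu := hcen u hu' u hu' v hv'
  have hqv := hcen v hv' u hu' v hv'
  have hru := hcen u hu' v hv' u hu'
  have hrv := hcen v hv' v hv' u hu'
  have hsu := hcen u hu' v hv' v hv'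
  have hsv := hcen v hv' v hv' v hv'
  have hdc : ∀ w y z, ⁅J w, J y⁆ = 0 → ⁅J w, J z⁆ = 0 → h.dcOmega w y z = h.B ⁅J y, J z⁆ w :=
    fun w y z h1 h2 => by
      simp [HermMetric.dcOmega, HermMetric.dOmega, HermMetric.omega, h1, h2, h.compat]
  have hzJ : ∀ x ∈ complexPart J a, ∀ y ∈ a, ⁅J y, x⁆ = 0 → ⁅J x, J y⁆ = 0 :=
    fun x hx y hy h0 => by
      rw [← lie_skew, lie_J_J_of_mem hJ hF.lie_eq_zero hy hx, h0, map_zero, neg_zero]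
  have hz : ∀ x ∈ complexPart J a, ∀ y ∈ a, ⁅J x, J (J y)⁆ = 0 := fun x hx y hy => by
    rw [hJJ, lie_neg, hF.lie_eq_zero _ hx.2 y hy, neg_zero]
  have hd := hpl u (J u) v (J v)
  rw [HermMetric.ddcOmega, huv, hlie, ← lie_skew u (J u), ← lie_skew u (J v),
    ← lie_skew v (J v)] at hd
  generalize hp' : ⁅J u, u⁆ = p at *
  generalize hq' : ⁅J u, v⁆ = q at *
  generalize hr' : ⁅J v, u⁆ = r at *
  generalize hs' : ⁅J v, v⁆ = s at *
  have hqr : ∀ y, ⁅J y, q⁆ = 0 → ⁅J y, r⁆ = 0 → ⁅J (J (q - r)), J y⁆ = 0 := fun y h1 h2 => by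
    rw [hJJ, ← lie_skew]
    simp [h1, h2]
  have hneg : ∀ w y z, h.dcOmega (-w) y z = -h.dcOmega w y z := fun w y z => by
    simp only [HermMetric.dcOmega, HermMetric.dOmega, HermMetric.omega, map_neg, neg_lie,
      LinearMap.neg_apply]
    ring
  have h0 : h.dcOmega 0 (J u) (J v) = 0 := by
    simp [HermMetric.dcOmega, HermMetric.dOmega, HermMetric.omega]
  simp only [hneg] at hd
  rw [h0, hdc p v (J v) (hzJ p hp v hv hpv) (hz p hp v hv),
    hdc r (J u) v (hz r hr u hu) (hzJ r hr v hv hrv),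
    hdc q u (J v) (hzJ q hq u hu hqu) (hz q hq v hv),
    hdc (J (q - r)) u v (hqr u hqu hru) (hqr v hqv hrv),
    hdc s u (J u) (hzJ s hs u hu hsu) (hz s hs u hu),
    hJJ, hJJ, neg_lie, lie_neg, lie_neg, lie_neg, hlie, ← lie_skew u (J v), hp', hq', hr', hs',
    h.compat] at hd
  have hn : h.B (p + s) (p + s) = t ^ 2 * h.B (q - r) (q - r) := by
    rw [eq_neg_of_add_eq_zero_left hps]
    simp only [map_neg, map_smul, LinearMap.neg_apply, LinearMap.smul_apply, h.compat, smul_eq_mul]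
    ring
  simp only [map_add, LinearMap.add_apply, map_neg, LinearMap.neg_apply, neg_neg,
    h.symm s p] at hn hd
  have hnn := h.B_self_nonneg
  have hqr0 := mul_nonneg (sub_pos.2 ht).le (hnn (q - r))
  have hp0 : p = 0 := h.eq_zero_of_B_self (by linarith [hnn p, hnn q, hnn r, hnn s])
  have hq0 : q = 0 := h.eq_zero_of_B_self (by linarith [hnn p, hnn q, hnn r, hnn s])
  have hr0 : r = 0 := h.eq_zero_of_B_self (by linarith [hnn p, hnn q, hnn r, hnn s])
  have hs0 : s = 0 := h.eq_zero_of_B_self (by linarith [hnn p, hnn q, hnn r, hnn s])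
  subst hp0 hq0 hr0 hs0
  have hsk : ∀ {x y : L}, ⁅x, y⁆ = 0 → ⁅y, x⁆ = 0 := fun {x y} hxy => by
    rw [← lie_skew, hxy, neg_zero]
  have hJuv : ⁅J u, J v⁆ = 0 := by rw [hlie, sub_zero, map_zero]
  refine (hF.isComplexAbelianIdeal hJ).exists_isKahler hh (frameProj J u v θ η) (frameProj_J hJJ)
    (hF.sub_frameProj_mem hJJ) (fun x => hF.frameProj_eq_zero hJJ) fun x y => ?_
  simp [frameProj_apply, huv, hsk huv, hp', hsk hp', hq', hsk hq', hr', hsk hr', hs', hsk hs',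
    hJuv, hsk hJuv]

theorem lie_lie_comm (hF : IsTotallyRealFrame J a u v θ η) (hJ : IsComplexStructure J)
    (hq : ⁅J u, v⁆ ∈ complexPart J a) (hr : ⁅J v, u⁆ ∈ complexPart J a) {x : L} (hx : x ∈ a) :
    ⁅J u, ⁅J v, x⁆⁆ = ⁅J v, ⁅J u, x⁆⁆ := by
  rw [← sub_eq_zero, ← lie_lie, lie_J_J hJ, hF.lie_eq_zero u hF.left_mem v hF.right_mem, zero_add]
  exact hF.lie_eq_zero _ (sub_mem hq hr).2 x hx

theorem exists_lie_lie_add_eq_zero [FiniteDimensional ℝ L] (hF : IsTotallyRealFrame J a u v θ η)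
    (hJ : IsComplexStructure J) {h : HermMetric J} (hh : h.PreservedOn (complexPart J a))
    (hq : ⁅J u, v⁆ ∈ complexPart J a) (hr : ⁅J v, u⁆ ∈ complexPart J a) {x : L} (hx : x ∈ a)
    (hux : ⁅J u, x⁆ ∈ complexPart J a) (hvx : ⁅J v, x⁆ ∈ complexPart J a) :
    ∃ w ∈ complexPart J a, ∀ y ∈ ({u, v} : Set L), ∀ z ∈ ({u, v} : Set L),
      ⁅J y, ⁅J z, x + w⁆⁆ = 0 := by
  have hb := hF.isComplexAbelianIdeal hJ
  let D (z : L) : complexPart J a →ₗ[ℝ] complexPart J a :=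
    (LieAlgebra.ad ℝ L (J z)).restrict (hb.lie_mem (J z))
  have hD : ∀ z (w : complexPart J a), (D z w : L) = ⁅J z, (w : L)⁆ := fun _ _ => rfl
  obtain ⟨w, h1, h2, h3, h4⟩ := exists_cocycle_correction
    (h.B.domRestrict₁₂ (complexPart J a) (complexPart J a)) (fun x y => h.symm x y)
    (fun x hx => h.posdef x (by simpa using hx)) (D u) (D v)
    (fun x y => hF.skew hJ hh hF.left_mem x.2 y.2) (fun x y => hF.skew hJ hh hF.right_mem x.2 y.2)
    (fun x => Subtype.ext (hF.lie_lie_comm hJ hq hr x.2.1)) ⟨_, hux⟩ ⟨_, hvx⟩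
    (Subtype.ext (hF.lie_lie_comm hJ hq hr hx))
  have hc : ∀ y z : L, ∀ hz : ⁅J z, x⁆ ∈ complexPart J a, D y (⟨_, hz⟩ + D z w) = 0 →
      ⁅J y, ⁅J z, x + w⁆⁆ = 0 := fun y z hz h0 => by
    have := congrArg (Subtype.val) h0
    simpa [hD] using this
  refine ⟨w, w.2, ?_⟩
  rintro y (rfl | rfl) z (rfl | rfl)
  exacts [hc _ _ hux h1, hc _ _ hvx h3, hc _ _ hux h2, hc _ _ hvx h4]

theorem exists_isKahler [FiniteDimensional ℝ L] (hF : IsTotallyRealFrame J a u v θ η)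
    (hJ : IsComplexStructure J) {h : HermMetric J} (hh : h.PreservedOn (complexPart J a))
    (hpl : h.IsPluriclosed)
    (hmem : ∀ w ∈ ({u, v} : Set L), ∀ x ∈ ({u, v} : Set L), ⁅J w, x⁆ ∈ complexPart J a)
    {t : ℝ} (ht : t ^ 2 < 1) (hps : ⁅J u, u⁆ + ⁅J v, v⁆ + t • J (⁅J u, v⁆ - ⁅J v, u⁆) = 0) :
    ∃ k : HermMetric J, k.IsKahler := by
  have hb := hF.isComplexAbelianIdeal hJ
  have hu : u ∈ ({u, v} : Set L) := .inl rfl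
  have hv : v ∈ ({u, v} : Set L) := .inr rfl
  obtain ⟨x, hx, hx0⟩ := hF.exists_lie_lie_add_eq_zero hJ hh (hmem u hu v hv) (hmem v hv u hu)
    hF.left_mem (hmem u hu u hu) (hmem v hv u hu)
  obtain ⟨y, hy, hy0⟩ := hF.exists_lie_lie_add_eq_zero hJ hh (hmem u hu v hv) (hmem v hv u hu)
    hF.right_mem (hmem u hu v hv) (hmem v hv v hv)
  have hF' := hF.add hJ.1 hx hy
  have hlu : ∀ z ∈ a, ⁅J (u + x), z⁆ = ⁅J u, z⁆ := fun z hz => by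
    rw [map_add, add_lie, hF.lie_eq_zero _ hx.2 z hz, add_zero]
  have hlv : ∀ z ∈ a, ⁅J (v + y), z⁆ = ⁅J v, z⁆ := fun z hz => by
    rw [map_add, add_lie, hF.lie_eq_zero _ hy.2 z hz, add_zero]
  have hmem' : ∀ z ∈ ({u, v} : Set L), ⁅J z, u + x⁆ ∈ complexPart J a ∧
      ⁅J z, v + y⁆ ∈ complexPart J a := fun z hz => by
    rw [lie_add, lie_add]
    exact ⟨add_mem (hmem z hz u hu) (hb.lie_mem _ x hx),
      add_mem (hmem z hz v hv) (hb.lie_mem _ y hy)⟩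
  set m := ⁅J u, u + x⁆ + ⁅J v, v + y⁆ + t • J (⁅J u, v + y⁆ - ⁅J v, u + x⁆) with hm
  have hm' : m = ⁅J u, x⁆ + ⁅J v, y⁆ + t • (⁅J u, J y⁆ - ⁅J v, J x⁆) := by
    rw [lie_J_J_of_mem hJ hF.lie_eq_zero hF.left_mem hy,
      lie_J_J_of_mem hJ hF.lie_eq_zero hF.right_mem hx, ← map_sub, hm, ← sub_eq_zero, ← hps]
    simp only [lie_add, map_sub, map_add]
    module
  have hmb : m ∈ complexPart J a := add_mem (add_mem (hmem' u hu).1 (hmem' v hv).2)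
    (Submodule.smul_mem _ _ (J_mem_complexPart hJ.1 (sub_mem (hmem' u hu).2 (hmem' v hv).1)))
  have hm0 : ∀ w ∈ ({u, v} : Set L), ⁅J w, m⁆ = 0 := fun w hw => by
    have hwa : w ∈ a := by
      rcases hw with rfl | rfl
      exacts [hF.left_mem, hF.right_mem]
    rw [hm, lie_add, lie_add, lie_smul, lie_J_J_of_mem hJ hF.lie_eq_zero hwa
      (sub_mem (hmem' u hu).2 (hmem' v hv).1), lie_sub]
    simp [hx0 w hw u hu, hx0 w hw v hv, hy0 w hw u hu, hy0 w hw v hv, -lie_add]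
  have hBu : ∀ z ∈ complexPart J a, h.B ⁅J u, z⁆ m = 0 := fun z hz => by
    rw [hF.skew hJ hh hF.left_mem hz hmb, hm0 u hu, map_zero, neg_zero]
  have hBv : ∀ z ∈ complexPart J a, h.B ⁅J v, z⁆ m = 0 := fun z hz => by
    rw [hF.skew hJ hh hF.right_mem hz hmb, hm0 v hv, map_zero, neg_zero]
  have hmz : m = 0 := h.eq_zero_of_B_self <| by
    have h0 : h.B (⁅J u, x⁆ + ⁅J v, y⁆ + t • (⁅J u, J y⁆ - ⁅J v, J x⁆)) m = 0 := by
      simp only [map_add, map_sub, map_smul, LinearMap.add_apply, LinearMap.sub_apply,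
        LinearMap.smul_apply, hBu x hx, hBv y hy, hBu _ (J_mem_complexPart hJ.1 hy),
        hBv _ (J_mem_complexPart hJ.1 hx)]
      simp
    rwa [← hm'] at h0
  have hza : ∀ z ∈ ({u + x, v + y} : Set L), z ∈ a := by
    rintro z (rfl | rfl)
    exacts [hF'.left_mem, hF'.right_mem]
  refine hF'.exists_isKahler_of_lie_lie_eq_zero hJ hh hpl ?_ ?_ ht ?_
  · rintro w (rfl | rfl) z hz
    · rw [hlu z (hza z hz)]
      rcases hz with rfl | rfl
      exacts [(hmem' u hu).1, (hmem' u hu).2]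
    · rw [hlv z (hza z hz)]
      rcases hz with rfl | rfl
      exacts [(hmem' v hv).1, (hmem' v hv).2]
  · have hlie : ∀ w ∈ ({u + x, v + y} : Set L), ∃ w' ∈ ({u, v} : Set L),
        ∀ z ∈ a, ⁅J w, z⁆ = ⁅J w', z⁆ := by
      rintro w (rfl | rfl)
      exacts [⟨u, hu, hlu⟩, ⟨v, hv, hlv⟩]
    intro w hw z hz r hr
    obtain ⟨w', hw', hlw⟩ := hlie w hw
    obtain ⟨z', hz', hlz⟩ := hlie z hz
    rw [hlw _ (lie_mem_right ℝ L a _ _ (hza r hr)), hlz _ (hza r hr)]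
    rcases hr with rfl | rfl
    exacts [hx0 w' hw' z' hz', hy0 w' hw' z' hz']
  · rw [hlu _ hF'.left_mem, hlv _ hF'.right_mem, hlu _ hF'.right_mem, hlv _ hF'.left_mem, ← hm, hmz]

end IsTotallyRealFrame

theorem even_finrank_of_J [FiniteDimensional ℝ L] (hJ : ∀ x, J (J x) = -x)
    (H : Submodule ℝ L) (hH : ∀ x ∈ H, J x ∈ H) : Even (finrank ℝ H) := by
  have h1 : J.restrict hH ∘ₗ J.restrict hH = (-1 : ℝ) • LinearMap.id := by
    ext x
    simp [hJ]
  have h2 := congrArg LinearMap.det h1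
  rw [LinearMap.det_comp, LinearMap.det_smul, LinearMap.det_id, mul_one] at h2
  by_contra hodd
  rw [(Nat.not_even_iff_odd.1 hodd).neg_one_pow] at h2
  nlinarith [mul_self_nonneg (LinearMap.det (J.restrict hH))]

theorem J_injective (hJ : ∀ x, J (J x) = -x) : Function.Injective J := fun x y hxy => by
  have := congrArg J hxy
  rwa [hJ, hJ, neg_inj] at this

theorem sup_map_J_eq_top [FiniteDimensional ℝ L] (hJ : ∀ x, J (J x) = -x) {n : ℕ}
    (hdim : finrank ℝ L = 2 * n) (hcodim : finrank ℝ a.toSubmodule + 2 = finrank ℝ L)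
    (ha : ¬ ∀ x ∈ a, J x ∈ a) : a.toSubmodule ⊔ a.toSubmodule.map J = ⊤ := by
  set H := a.toSubmodule ⊔ a.toSubmodule.map J with hH
  have hJH : ∀ x ∈ H, J x ∈ H := fun x hx => by
    obtain ⟨y, hy, _, ⟨z, hz, rfl⟩, rfl⟩ := Submodule.mem_sup.1 hx
    rw [map_add, hJ]
    exact add_mem (Submodule.mem_sup_right ⟨y, hy, rfl⟩)
      (Submodule.mem_sup_left (a.toSubmodule.neg_mem hz))
  have hlt : a.toSubmodule < H := lt_of_le_of_ne le_sup_left fun h =>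
    ha fun x hx => by
      have := hJH x (h ▸ hx)
      rwa [← h] at this
  have h1 := Submodule.finrank_lt_finrank_of_lt hlt
  have h2 := H.finrank_le
  obtain ⟨k, hk⟩ := even_finrank_of_J hJ H hJH
  exact Submodule.eq_top_of_finrank_eq (by omega)

theorem finrank_complexPart [FiniteDimensional ℝ L] (hJ : ∀ x, J (J x) = -x)
    (hcodim : finrank ℝ a.toSubmodule + 2 = finrank ℝ L)
    (htop : a.toSubmodule ⊔ a.toSubmodule.map J = ⊤) :
    finrank ℝ (complexPart J a) + 2 = finrank ℝ a.toSubmodule := by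
  have h1 := Submodule.finrank_sup_add_finrank_inf_eq a.toSubmodule (a.toSubmodule.map J)
  have h2 : a.toSubmodule ⊓ a.toSubmodule.map J = complexPart J a := by
    ext x
    refine and_congr_right fun _ => ⟨?_, fun h => ⟨-J x, a.toSubmodule.neg_mem h, by simp [hJ]⟩⟩
    rintro ⟨y, hy, rfl⟩
    simpa [hJ] using hy
  rw [htop, h2, finrank_top,
    (Submodule.equivMapOfInjective J (J_injective hJ) a.toSubmodule).symm.finrank_eq] at h1
  omega

theorem exists_isTotallyRealFrame [FiniteDimensional ℝ L] (hJ : IsComplexStructure J)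
    (hab : ∀ x ∈ a, ∀ y ∈ a, ⁅x, y⁆ = 0)
    (hcodim : finrank ℝ a.toSubmodule + 2 = finrank ℝ L)
    (htop : a.toSubmodule ⊔ a.toSubmodule.map J = ⊤)
    (huni : IsUnimodularLie L) {n : ℕ} (hdim : finrank ℝ L = 2 * n)
    {g : HermMetric J} (hg : g.IsBalanced n) :
    ∃ (u v : L) (θ η : L →ₗ[ℝ] ℝ) (t : ℝ), IsTotallyRealFrame J a u v θ η ∧ t ^ 2 < 1 ∧
      ⁅J u, u⁆ + ⁅J v, v⁆ + t • J (⁅J u, v⁆ - ⁅J v, u⁆) = 0 := by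
  have hJJ := hJ.1
  obtain ⟨u, hu, v, hv, huu, hvv, huv, hub, hvb, hdec⟩ := exists_orthonormal_pair g.B g.symm
    g.posdef (inf_le_left : complexPart J a ≤ a.toSubmodule)
    (finrank_complexPart hJJ hcodim htop)
  have hJl := g.B_J_left hJJ
  have huJ := g.B_self_J hJJ u
  have hvJ := g.B_self_J hJJ v
  obtain ⟨t, htv⟩ : ∃ t, g.B v (J u) = t := ⟨_, rfl⟩
  have htu : g.B u (J v) = -t := by rw [← htv, g.symm v, hJl, neg_neg]
  have hvu : g.B v u = 0 := by rw [g.symm, huv]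
  have hJuv : g.B (J u) v = t := by rw [g.symm, htv]
  have hw : g.B (v - t • J u) (v - t • J u) = 1 - t ^ 2 := by
    simp only [map_sub, map_smul, LinearMap.sub_apply, LinearMap.smul_apply, smul_eq_mul, hvv,
      htv, hJuv, g.compat, huu]
    ring
  have ht : t ^ 2 < 1 := by
    have := g.posdef (v - t • J u) fun h0 => by
      rw [sub_eq_zero] at h0
      have hvb' : v ∈ complexPart J a := ⟨hv, by
        show J v ∈ a
        rw [h0, map_smul, hJJ]
        exact a.smul_mem _ (neg_mem hu)⟩
      rw [hvb v hvb'] at hvv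
      exact zero_ne_one hvv
    linarith
  have ht0 : 1 - t ^ 2 ≠ 0 := by linarith
  have hJa : ∀ x ∈ a, g.B u (J x) = -t * g.B v x ∧ g.B v (J x) = t * g.B u x := fun x hx => by
    have hx' := J_mem_complexPart hJJ (hdec x hx)
    have h1 := hub _ hx'
    have h2 := hvb _ hx'
    simp only [map_sub, map_smul, smul_eq_mul, huJ, hvJ, htv, htu] at h1 h2
    constructor <;> linarith
  let θ : L →ₗ[ℝ] ℝ := (1 - t ^ 2)⁻¹ • (g.B u + t • g.B (J v))
  let η : L →ₗ[ℝ] ℝ := (1 - t ^ 2)⁻¹ • (g.B v - t • g.B (J u))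
  have hθ : ∀ x, θ x = (1 - t ^ 2)⁻¹ * (g.B u x + t * g.B (J v) x) := fun _ => rfl
  have hη : ∀ x, η x = (1 - t ^ 2)⁻¹ * (g.B v x - t * g.B (J u) x) := fun _ => rfl
  have hθa : ∀ x ∈ a, θ x = g.B u x := fun x hx => by
    rw [hθ, hJl, (hJa x hx).2]
    field_simp
    ring
  have hηa : ∀ x ∈ a, η x = g.B v x := fun x hx => by
    rw [hη, hJl, (hJa x hx).1]
    field_simp
  have hF : IsTotallyRealFrame J a u v θ η :=
    { lie_eq_zero := hab
      exists_eq := fun z => by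
        have hz : z ∈ a.toSubmodule ⊔ a.toSubmodule.map J := htop ▸ trivial
        obtain ⟨x, hx, _, ⟨y, hy, rfl⟩, rfl⟩ := Submodule.mem_sup.1 hz
        exact ⟨x, hx, y, hy, rfl⟩
      left_mem := hu
      right_mem := hv
      θ_left := by rw [hθa u hu, huu]
      θ_right := by rw [hθa v hv, huv]
      η_left := by rw [hηa u hu, hvu]
      η_right := by rw [hηa v hv, hvv]
      θ_J := fun x hx => by rw [hθ, g.compat, (hJa x hx).1]; ring
      η_J := fun x hx => by rw [hη, g.compat, (hJa x hx).2]; ring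
      J_sub_mem := fun x hx => by
        have := (hdec x hx).2
        rwa [sub_sub, ← hθa x hx, ← hηa x hx] at this }
  refine ⟨u, v, θ, η, t, hF, ht, ?_⟩
  obtain ⟨σ, hσ⟩ : ∃ σ : ℝ, σ ^ 2 * (1 - t ^ 2) = 1 :=
    ⟨(√(1 - t ^ 2))⁻¹, by rw [inv_pow, Real.sq_sqrt (by linarith), inv_mul_cancel₀ ht0]⟩
  have hσ0 : σ ≠ 0 := by
    rintro rfl
    simp at hσ
  obtain ⟨w, hwdef⟩ : ∃ w, w = σ • (v - t • J u) := ⟨_, rfl⟩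
  have hww : g.B w w = 1 := by
    rw [hwdef, LinearMap.map_smul₂, map_smul, hw, smul_eq_mul, smul_eq_mul]
    linear_combination hσ
  have huw : g.B u w = 0 := by simp [hwdef, huv, huJ]
  have hJuw : g.B (J u) w = 0 := by simp [hwdef, hJuv, g.compat, huu]
  have huJw : g.B u (J w) = 0 := by rw [← neg_eq_zero, ← hJl, hJuw]
  have hsum := hg.sum_lie_frame_eq_zero hJJ huni hdim ![u, J u, w, J w] (fun i j => by
    have h1 : g.B (J u) u = 0 := by rw [g.symm, huJ]
    have h2 : g.B w u = 0 := by rw [g.symm, huw]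
    have h3 : g.B w (J u) = 0 := by rw [g.symm, hJuw]
    have h4 : g.B (J w) u = 0 := by rw [g.symm, huJw]
    have h5 := g.B_self_J hJJ w
    have h6 : g.B (J w) w = 0 := by rw [g.symm, h5]
    fin_cases i <;> fin_cases j <;> 
      simp [huu, huJ, huw, hJuw, huJw, hww, g.compat, h1, h2, h3, h4, h5, h6]) <|
    fun x hx => by
      have hxu : g.B u x = 0 := hx 0
      have hxJu : g.B (J u) x = 0 := hx 1
      have hxw : g.B w x = 0 := hx 2
      have hxJw : g.B (J w) x = 0 := hx 3
      have hxv : g.B v x = 0 := by simpa [hwdef, hσ0, hxJu] using hxw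
      have hxJv : g.B (J v) x = 0 := by simpa [hwdef, hσ0, hxu, hJJ] using hxJw
      have hxb := hF.sub_frameProj_mem hJJ x
      rw [frameProj_apply, hθ, hθ, hη, hη, g.compat, g.compat, hxu, hxv, hxJu, hxJv, ← neg_neg
        (g.B u (J x)), ← neg_neg (g.B v (J x)), ← hJl, ← hJl, hxJu, hxJv] at hxb
      replace hxb : x ∈ complexPart J a := by simpa using hxb
      exact hab x hxb.1 _ hxb.2
  have huvl := hab u hu v hv
  have hlie : ⁅J u, J v⁆ = J (⁅J u, v⁆ - ⁅J v, u⁆) := by rw [lie_J_J hJ, huvl, zero_add]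
  have hwl : ⁅w, J w⁆ = -(σ ^ 2) • (⁅J v, v⁆ + t • ⁅J u, J v⁆ + t ^ 2 • ⁅J u, u⁆) := by
    have hvul := hab v hv u hu
    rw [hwdef]
    simp only [map_smul, map_sub, hJJ, smul_lie, lie_smul, sub_lie, lie_sub, lie_neg, hvul]
    rw [← lie_skew v (J v)]
    module
  simp only [Fin.sum_univ_four, Matrix.cons_val, hJJ, lie_neg] at hsum
  rw [lie_skew, lie_skew, hwl, ← lie_skew u (J u), hlie] at hsum
  generalize ⁅J u, u⁆ = p at *
  generalize ⁅J v, v⁆ = s at *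
  generalize J (⁅J u, v⁆ - ⁅J v, u⁆) = m at *
  have h2 : p + σ ^ 2 • (s + t • m + t ^ 2 • p) = 0 := by
    have : (-2 : ℝ) • (p + σ ^ 2 • (s + t • m + t ^ 2 • p)) = 0 := by
      linear_combination (norm := module) hsum
    exact (smul_eq_zero.1 this).resolve_left (by norm_num)
  have h3 : σ ^ 2 • (p + s + t • m) = (σ ^ 2 * (1 - t ^ 2) - 1) • p := by
    linear_combination (norm := module) h2
  rw [hσ, sub_self, zero_smul] at h3
  exact (smul_eq_zero.1 h3).resolve_left (pow_ne_zero 2 hσ0)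

end HermMetric

theorem fino_vezzoni_stmt2
    {L : Type*} [LieRing L] [LieAlgebra ℝ L] [FiniteDimensional ℝ L]
    (a : LieIdeal ℝ L)
    (habel : ∀ u ∈ a.toSubmodule, ∀ v ∈ a.toSubmodule, ⁅u, v⁆ = (0 : L))
    (hcodim : finrank ℝ ↥a.toSubmodule + 2 = finrank ℝ L)
    (J : L →ₗ[ℝ] L) (hJ : IsComplexStructure J)
    (huni : IsUnimodularLie L)
    (n : ℕ) (hdim : finrank ℝ L = 2 * n)
    (hbal : ∃ g : HermMetric J, g.IsBalanced n)
    (hplu : ∃ g : HermMetric J, g.IsPluriclosed) :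
    ∃ g : HermMetric J, g.IsKahler := by
  obtain ⟨g, hg⟩ := hbal
  obtain ⟨h, hh⟩ := hplu
  have hJJ := hJ.1
  obtain ⟨f, hf, -⟩ := exists_orthonormal_basis_extension g.B g.symm g.posdef
    (ι := Fin (2 * n)) (by simp [hdim]) 0 ∅ (by simp)
  have hsum := hg.sum_lie_eq_zero hJJ huni f hf
  by_cases ha : ∀ x ∈ a, J x ∈ a
  · have hb : IsComplexAbelianIdeal J a.toSubmodule :=
      ⟨ha, fun z x hx => lie_mem_right ℝ L a z x hx, habel⟩
    exact hb.exists_isKahler_of_finrank hcodim hJ huni hdim hg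
      (hb.preservedOn_of_isPluriclosed hh hJJ f hsum)
  · obtain ⟨u, v, θ, η, t, hF, ht, hps⟩ := exists_isTotallyRealFrame hJ habel hcodim
      (sup_map_J_eq_top hJJ hdim hcodim ha) huni hdim hg
    have hP := (hF.isComplexAbelianIdeal hJ).preservedOn_of_isPluriclosed hh hJJ f hsum
    have hmem : ∀ z, ∀ x ∈ a, ⁅z, x⁆ ∈ a := fun z x hx => lie_mem_right ℝ L a z x hx
    have hq := sub_mem (hmem (J u) v hF.right_mem) (hmem (J v) u hF.left_mem)
    obtain ⟨h1, h2, h3, h4⟩ := hF.lie_mem_complexPart hJ hP huni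
      ⟨add_mem (hmem _ _ hF.left_mem) (hmem _ _ hF.right_mem), by
        show J _ ∈ a
        rw [eq_neg_of_add_eq_zero_left hps, map_neg, map_smul, hJJ]
        exact neg_mem (a.smul_mem t (neg_mem hq))⟩
    refine hF.exists_isKahler hJ hP hh ?_ ht hps
    rintro w (rfl | rfl) x (rfl | rfl) <;> assumption
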